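/- For every lattice point m ∈ P ∩ ℤⁿ, the maximum over m̃ ∈ P ∩ ℤⁿ of ⟨m̃, ∇ψ(m)⟩ − ψ(m̃) is attained only at m̃ = m; consequently ∇ψ(m) ∉ A_trop(P ∩ ℤⁿ, ψ), and the GQ limit amoeba A_lim^GQ(P, ψ) contains no lattice point of the interior of P, i.e. A_lim^GQ(P, ψ) ∩ int P ∩ ℤⁿ = ∅. -/

import Mathlib

open Set
open scoped RealInnerProductSpace

/-- The set of lattice points of `P ⊆ ℝⁿ`: points of `P` with all coordinates integral. -/
def latticePoints (n : ℕ) (P : Set (EuclideanSpace ℝ (Fin n))) :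
    Set (EuclideanSpace ℝ (Fin n)) :=
  {x ∈ P | ∀ i, ∃ z : ℤ, x i = (z : ℝ)}

/-- The normal cone `C_p(P) = {c : ⟨c, p − q⟩ ≥ 0 for all q ∈ P}` of `P` at `p`. -/
def normalCone (n : ℕ) (P : Set (EuclideanSpace ℝ (Fin n)))
    (p : EuclideanSpace ℝ (Fin n)) : Set (EuclideanSpace ℝ (Fin n)) :=
  {c | ∀ q ∈ P, 0 ≤ ⟪c, p - q⟫}

/-- The tropical amoeba `A_trop(S, v)`: the set of `u ∈ ℝⁿ` where the maximum of
`m ↦ ⟨m, u⟩ − v(m)` over `S` is attained by at least two distinct elements of `S`. -/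
def tropicalAmoeba (n : ℕ) (S : Set (EuclideanSpace ℝ (Fin n)))
    (v : EuclideanSpace ℝ (Fin n) → ℝ) : Set (EuclideanSpace ℝ (Fin n)) :=
  {u | ∃ m₁ ∈ S, ∃ m₂ ∈ S, m₁ ≠ m₂ ∧
    (∀ m ∈ S, ⟪m, u⟫ - v m ≤ ⟪m₁, u⟫ - v m₁) ∧
    ⟪m₁, u⟫ - v m₁ = ⟪m₂, u⟫ - v m₂}

/-- The GQ limit amoeba `A_lim^GQ(P, ψ) = {x ∈ P : ∃ c ∈ C_x(P), ∇ψ(x) + c ∈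
A_trop(P ∩ ℤⁿ, ψ)}`. -/
noncomputable def gqLimitAmoeba (n : ℕ) (P : Set (EuclideanSpace ℝ (Fin n)))
    (ψ : EuclideanSpace ℝ (Fin n) → ℝ) : Set (EuclideanSpace ℝ (Fin n)) :=
  {x ∈ P | ∃ c ∈ normalCone n P x,
    gradient ψ x + c ∈ tropicalAmoeba n (latticePoints n P) ψ}

section StrongConvexity

variable {E : Type*} [NormedAddCommGroup E] [InnerProductSpace ℝ E] [CompleteSpace E]
  {U : Set E} {ψ : E → ℝ} {c : ℝ}

lemma differentiableAt_gradient_of_contDiffOn (hU : IsOpen U) (hψ : ContDiffOn ℝ 2 ψ U)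
    {x : E} (hx : x ∈ U) : DifferentiableAt ℝ (gradient ψ) x := by
  have h : DifferentiableAt ℝ (fderiv ℝ ψ) x :=
    ((hψ.contDiffAt (hU.mem_nhds hx)).fderiv_right (m := 1) (by norm_num)).differentiableAt
      (by norm_num)
  exact (InnerProductSpace.toDual ℝ E).symm.toContinuousLinearEquiv.differentiableAt.comp x h

/-- A lower bound on the Hessian makes the gradient strongly monotone. -/
lemma two_mul_norm_sq_le_inner_gradient_sub (hU : IsOpen U) (hUconv : Convex ℝ U)
    (hψ : ContDiffOn ℝ 2 ψ U)
    (hHess : ∀ x ∈ U, ∀ v : E, 2 * c * ‖v‖ ^ 2 ≤ ⟪v, fderiv ℝ (gradient ψ) x v⟫)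
    {x y : E} (hx : x ∈ U) (hy : y ∈ U) :
    2 * c * ‖y - x‖ ^ 2 ≤ ⟪y - x, gradient ψ y - gradient ψ x⟫ := by
  have hderiv : ∀ z ∈ U, HasFDerivWithinAt (fun w => ⟪y - x, gradient ψ w⟫)
      ((innerSL ℝ (y - x)).comp (fderiv ℝ (gradient ψ) z)) U z := fun z hz =>
    ((innerSL ℝ (y - x)).hasFDerivAt.comp z
      (differentiableAt_gradient_of_contDiffOn hU hψ hz).hasFDerivAt).hasFDerivWithinAt
  obtain ⟨z, hz, hzeq⟩ := domain_mvt hderiv hUconv hx hy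
  have hle := hHess z (hUconv.segment_subset hx hy hz) (y - x)
  rw [inner_sub_right, hzeq]
  exact hle

/-- The quadratic lower bound for a function whose Hessian is bounded below by `2c`. -/
lemma add_inner_gradient_add_norm_sq_le (hU : IsOpen U) (hUconv : Convex ℝ U)
    (hψ : ContDiffOn ℝ 2 ψ U)
    (hHess : ∀ x ∈ U, ∀ v : E, 2 * c * ‖v‖ ^ 2 ≤ ⟪v, fderiv ℝ (gradient ψ) x v⟫)
    {x y : E} (hx : x ∈ U) (hy : y ∈ U) :
    ψ x + ⟪gradient ψ x, y - x⟫ + c * ‖y - x‖ ^ 2 ≤ ψ y := by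
  have hderiv : ∀ z ∈ U, HasFDerivWithinAt
      (fun w => ψ w - ⟪gradient ψ x, w⟫ - c * ‖w - x‖ ^ 2)
      (innerSL ℝ (gradient ψ z) - innerSL ℝ (gradient ψ x) - c • (2 • innerSL ℝ (z - x))) U z := by
    intro z hz
    have hψz : HasFDerivAt ψ (innerSL ℝ (gradient ψ z)) z :=
      ((hψ.contDiffAt (hU.mem_nhds hz)).differentiableAt
        (by norm_num)).hasGradientAt.hasFDerivAt
    have hsq : HasFDerivAt (fun w => ‖w - x‖ ^ 2) (2 • innerSL ℝ (z - x)) z := by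
      simpa using ((hasFDerivAt_id z).sub_const x).norm_sq
    exact ((hψz.sub (innerSL ℝ (gradient ψ x)).hasFDerivAt).sub
      (hsq.const_mul c)).hasFDerivWithinAt
  obtain ⟨z, hz, hzeq⟩ := domain_mvt hderiv hUconv hx hy
  have hzU := hUconv.segment_subset hx hy hz
  rw [segment_eq_image'] at hz
  obtain ⟨t, ⟨ht, -⟩, rfl⟩ := hz
  have hmono := two_mul_norm_sq_le_inner_gradient_sub hU hUconv hψ hHess hx hzU
  simp only [add_sub_cancel_left, norm_smul, Real.norm_eq_abs, mul_pow, sq_abs,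
    inner_smul_left, conj_trivial, sub_apply, smul_apply,
    innerSL_apply_apply, real_inner_self_eq_norm_sq, sub_self, norm_zero, smul_eq_mul,
    nsmul_eq_mul, Nat.cast_ofNat] at hmono hzeq
  rw [real_inner_comm, inner_sub_left] at hmono
  rw [inner_sub_right]
  rcases ht.eq_or_lt with rfl | ht
  · simp only [zero_smul, add_zero, zero_mul, mul_zero, sub_self] at hzeq
    linarith
  · have hdiv : 2 * c * t * ‖y - x‖ ^ 2 ≤ ⟪gradient ψ (x + t • (y - x)), y - x⟫
        - ⟪gradient ψ x, y - x⟫ := by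
      refine le_of_mul_le_mul_left ?_ ht
      linarith
    linarith

end StrongConvexity

lemma eq_zero_of_mem_normalCone_of_mem_interior {n : ℕ} {P : Set (EuclideanSpace ℝ (Fin n))}
    {x d : EuclideanSpace ℝ (Fin n)} (hx : x ∈ interior P) (hd : d ∈ normalCone n P x) :
    d = 0 := by
  have htend : Filter.Tendsto (fun t : ℝ => x + t • d) (nhdsWithin 0 (Ioi 0)) (nhds x) := by
    have hcont : Continuous fun t : ℝ => x + t • d := by fun_prop
    simpa using (hcont.tendsto 0).mono_left nhdsWithin_le_nhds
  obtain ⟨t, htP, ht⟩ := ((htend.eventually (mem_interior_iff_mem_nhds.1 hx)).and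
    self_mem_nhdsWithin).exists
  have hle := hd _ htP
  simp only [sub_add_cancel_left, inner_neg_right, inner_smul_right,
    real_inner_self_eq_norm_sq] at hle
  by_contra hne
  have := mul_pos (mem_Ioi.1 ht) (pow_pos (norm_pos_iff.2 hne) 2)
  linarith

lemma notMem_tropicalAmoeba_of_forall_lt {n : ℕ} {S : Set (EuclideanSpace ℝ (Fin n))}
    {v : EuclideanSpace ℝ (Fin n) → ℝ} {u m : EuclideanSpace ℝ (Fin n)} (hm : m ∈ S)
    (hlt : ∀ m' ∈ S, m' ≠ m → ⟪m', u⟫ - v m' < ⟪m, u⟫ - v m) :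
    u ∉ tropicalAmoeba n S v := by
  rintro ⟨m₁, hm₁, m₂, hm₂, hne, hmax, heq⟩
  by_cases h : m₁ = m
  · subst h
    exact (hlt m₂ hm₂ hne.symm).ne' heq
  · exact (hlt m₁ hm₁ h).not_ge (hmax m hm)

/-- the GQ limit amoeba avoids interior lattice points.
Let `P ⊆ ℝⁿ` be a compact lattice polytope and `ψ` a `C²` function on an open convex
neighborhood `U` of `P` with `Hess_x ψ ≥ 2c·Id` for some `c > 0`.  Then for every lattice
point `m ∈ P ∩ ℤⁿ`, the maximum over `m̃ ∈ P ∩ ℤⁿ` of `⟨m̃, ∇ψ(m)⟩ − ψ(m̃)` is attained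
only at `m̃ = m`; consequently `∇ψ(m) ∉ A_trop(P ∩ ℤⁿ, ψ)` and the GQ limit amoeba
contains no lattice point of the interior of `P`. -/
theorem gq_amoeba_avoids_lattice_points {n : ℕ}
    (P : Set (EuclideanSpace ℝ (Fin n)))
    (hPcomp : IsCompact P)
    (hlatne : (latticePoints n P).Nonempty) (hlatfin : (latticePoints n P).Finite)
    (hhull : P = convexHull ℝ (latticePoints n P))
    (U : Set (EuclideanSpace ℝ (Fin n))) (hUopen : IsOpen U) (hUconv : Convex ℝ U)
    (hPU : P ⊆ U)
    (ψ : EuclideanSpace ℝ (Fin n) → ℝ) (hψ : ContDiffOn ℝ 2 ψ U)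
    (c : ℝ) (hc : 0 < c)
    (hHess : ∀ x ∈ U, ∀ v : EuclideanSpace ℝ (Fin n),
      2 * c * ‖v‖ ^ 2 ≤ ⟪v, fderiv ℝ (gradient ψ) x v⟫) :
    (∀ m ∈ latticePoints n P, ∀ m' ∈ latticePoints n P, m' ≠ m →
      ⟪m', gradient ψ m⟫ - ψ m' < ⟪m, gradient ψ m⟫ - ψ m) ∧
    (∀ m ∈ latticePoints n P,
      gradient ψ m ∉ tropicalAmoeba n (latticePoints n P) ψ) ∧
    gqLimitAmoeba n P ψ ∩ interior P ∩ {x | ∀ i, ∃ z : ℤ, x i = (z : ℝ)} = ∅ := by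
  have hlt : ∀ m ∈ latticePoints n P, ∀ m' ∈ latticePoints n P, m' ≠ m →
      ⟪m', gradient ψ m⟫ - ψ m' < ⟪m, gradient ψ m⟫ - ψ m := by
    intro m hm m' hm' hne
    have hle := add_inner_gradient_add_norm_sq_le hUopen hUconv hψ hHess
      (hPU hm.1) (hPU hm'.1)
    have hpos := mul_pos hc (pow_pos (norm_pos_iff.2 (sub_ne_zero.2 hne)) 2)
    rw [real_inner_comm, inner_sub_left] at hle
    linarith
  have hnotMem : ∀ m ∈ latticePoints n P,
      gradient ψ m ∉ tropicalAmoeba n (latticePoints n P) ψ := fun m hm =>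
    notMem_tropicalAmoeba_of_forall_lt hm (hlt m hm)
  refine ⟨hlt, hnotMem, eq_empty_iff_forall_notMem.2 ?_⟩
  rintro x ⟨⟨⟨hxP, d, hd, hmem⟩, hxint⟩, hxlat⟩
  rw [eq_zero_of_mem_normalCone_of_mem_interior hxint hd, add_zero] at hmem
  exact hnotMem x ⟨hxP, hxlat⟩ hmem
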